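/- (Reich-type fixed point theorem for multi-valued maps) Let (X, p) be a complete partial metric space and let T be a map assigning to each x ∈ X a nonempty, closed (in the partial metric topology), bounded subset Tx ⊆ X. Suppose there are constants α, β, γ ≥ 0 with α + β + γ < 1 such that H_p(Tx, Ty) ≤ α·p(Tx, x) + β·p(Ty, y) + γ·p(x, y) for all x, y ∈ X, where p(A, x) = inf{p(a, x) : a ∈ A}. Then T has a fixed point: there exists x ∈ X with x ∈ Tx. -/

import Mathlib

/-- The topology of a partial metric space, generated by the open balls
`B_p(x, ε) = {y : p x y < p x x + ε}`. -/
def pmTop {X : Type*} (p : X → X → ℝ) : TopologicalSpace X :=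
  TopologicalSpace.generateFrom
    {s : Set X | ∃ c : X, ∃ ε : ℝ, 0 < ε ∧ s = {y : X | p c y < p c c + ε}}

/-- `p(x, A) = inf {p(x, a) : a ∈ A}`. -/
noncomputable def pmDist {X : Type*} (p : X → X → ℝ) (x : X) (A : Set X) : ℝ :=
  sInf ((fun a => p x a) '' A)

/-- `p(A, x) = inf {p(a, x) : a ∈ A}`. -/
noncomputable def pmDistL {X : Type*} (p : X → X → ℝ) (A : Set X) (x : X) : ℝ :=
  sInf ((fun a => p a x) '' A)

/-- `δ_p(A, B) = sup {p(a, B) : a ∈ A}`. -/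
noncomputable def pmDelta {X : Type*} (p : X → X → ℝ) (A B : Set X) : ℝ :=
  sSup ((fun a => pmDist p a B) '' A)

/-- `H_p(A, B) = max {δ_p(A, B), δ_p(B, A)}`. -/
noncomputable def pmH {X : Type*} (p : X → X → ℝ) (A B : Set X) : ℝ :=
  max (pmDelta p A B) (pmDelta p B A)

/-- A subset `A` is bounded if there are `x₀ ∈ X` and `M ≥ 0` with `p x₀ a ≤ M` for all
`a ∈ A`. -/
def pmBounded {X : Type*} (p : X → X → ℝ) (A : Set X) : Prop :=
  ∃ x₀ : X, ∃ M : ℝ, 0 ≤ M ∧ ∀ a ∈ A, p x₀ a ≤ M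

/-- A sequence is Cauchy in a partial metric space if `p (x n) (x m)` converges to some
real number as `n, m → ∞`. -/
def pmCauchy {X : Type*} (p : X → X → ℝ) (x : ℕ → X) : Prop :=
  ∃ a : ℝ, Filter.Tendsto (fun q : ℕ × ℕ => p (x q.1) (x q.2))
    (Filter.atTop ×ˢ Filter.atTop) (nhds a)

/-- A sequence converges to `l` in a partial metric space if
`lim p (x n) l = lim p (x n) (x n) = p l l`. -/
def pmConvergesTo {X : Type*} (p : X → X → ℝ) (x : ℕ → X) (l : X) : Prop :=
  Filter.Tendsto (fun n => p (x n) l) Filter.atTop (nhds (p l l)) ∧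
  Filter.Tendsto (fun n => p (x n) (x n)) Filter.atTop (nhds (p l l))

/-- A partial metric space is complete if every Cauchy sequence converges. -/
def pmComplete {X : Type*} (p : X → X → ℝ) : Prop :=
  ∀ x : ℕ → X, pmCauchy p x → ∃ l : X, pmConvergesTo p x l

open Filter Topology

section PartialMetric

variable {X : Type*} {p : X → X → ℝ}

theorem exists_ball_subset_of_isOpen_pmTop
    (hp4 : ∀ x y z : X, p x y ≤ p x z + p z y - p z z) {U : Set X}
    (hU : @IsOpen X (pmTop p) U) {x : X} (hx : x ∈ U) :
    ∃ ε : ℝ, 0 < ε ∧ ∀ y, p x y < p x x + ε → y ∈ U := by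
  change TopologicalSpace.GenerateOpen _ U at hU
  induction hU with
  | basic s hs =>
    obtain ⟨c, ε, -, rfl⟩ := hs
    have hx' : p c x < p c c + ε := hx
    refine ⟨p c c + ε - p c x, by linarith, fun y hy => ?_⟩
    have := hp4 c y x
    change p c y < p c c + ε
    linarith
  | univ => exact ⟨1, one_pos, fun _ _ => trivial⟩
  | inter s t _ _ ihs iht =>
    obtain ⟨ε, hε, h⟩ := ihs hx.1
    obtain ⟨δ, hδ, h'⟩ := iht hx.2
    exact ⟨min ε δ, lt_min hε hδ, fun y hy =>
      ⟨h y (by linarith [min_le_left ε δ]), h' y (by linarith [min_le_right ε δ])⟩⟩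
  | sUnion S _ ih =>
    obtain ⟨s, hs, hxs⟩ := hx
    obtain ⟨ε, hε, h⟩ := ih s hs hxs
    exact ⟨ε, hε, fun y hy => ⟨s, hs, h y hy⟩⟩

theorem exists_lt_of_pmDist_lt {x : X} {A : Set X} (hA : A.Nonempty) {r : ℝ}
    (h : pmDist p x A < r) : ∃ a ∈ A, p x a < r := by
  obtain ⟨_, ⟨a, ha, rfl⟩, har⟩ := exists_lt_of_csInf_lt (hA.image _) h
  exact ⟨a, ha, har⟩

theorem pmDist_le (h0 : ∀ x y, 0 ≤ p x y) {x a : X} {A : Set X} (ha : a ∈ A) :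
    pmDist p x A ≤ p x a :=
  csInf_le ⟨0, by rintro _ ⟨b, -, rfl⟩; exact h0 x b⟩ ⟨a, ha, rfl⟩

theorem pmDistL_eq_pmDist (hp3 : ∀ x y : X, p x y = p y x) (A : Set X) (x : X) :
    pmDistL p A x = pmDist p x A := by
  simp only [pmDistL, pmDist, hp3 _ x]

theorem mem_of_isClosed_of_pmDist_le (hp4 : ∀ x y z : X, p x y ≤ p x z + p z y - p z z)
    {A : Set X} (hA : A.Nonempty) (hcl : @IsClosed X (pmTop p) A) {x : X}
    (h : pmDist p x A ≤ p x x) : x ∈ A := by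
  by_contra hx
  obtain ⟨ε, hε, hball⟩ := exists_ball_subset_of_isOpen_pmTop hp4
    (@IsClosed.isOpen_compl X (pmTop p) A hcl) hx
  obtain ⟨a, ha, hlt⟩ := exists_lt_of_pmDist_lt hA (show pmDist p x A < p x x + ε by linarith)
  exact hball a hlt ha

theorem pmDist_le_pmDist_add (hp1 : ∀ x y : X, 0 ≤ p x x ∧ p x x ≤ p x y)
    (hp4 : ∀ x y z : X, p x y ≤ p x z + p z y - p z z)
    {A : Set X} (hA : A.Nonempty) (x y : X) :
    pmDist p x A ≤ p x y + pmDist p y A := by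
  refine le_of_forall_pos_le_add fun ε hε => ?_
  obtain ⟨a, ha, hlt⟩ :=
    exists_lt_of_pmDist_lt hA (show pmDist p y A < pmDist p y A + ε by linarith)
  have := pmDist_le (fun x y => (hp1 x y).1.trans (hp1 x y).2) (x := x) ha
  linarith [hp4 x a y, (hp1 y y).1]

theorem pmDist_le_pmH (hp1 : ∀ x y : X, 0 ≤ p x x ∧ p x x ≤ p x y)
    (hp3 : ∀ x y : X, p x y = p y x)
    (hp4 : ∀ x y z : X, p x y ≤ p x z + p z y - p z z)
    {A B : Set X} (hA : pmBounded p A) (hB : B.Nonempty) {a : X} (ha : a ∈ A) :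
    pmDist p a B ≤ pmH p A B := by
  obtain ⟨c, M, -, hM⟩ := hA
  suffices hbdd : BddAbove ((fun a => pmDist p a B) '' A) from
    (le_csSup hbdd ⟨a, ha, rfl⟩).trans (le_max_left _ _)
  refine ⟨M + pmDist p c B, ?_⟩
  rintro _ ⟨x, hx, rfl⟩
  have := pmDist_le_pmDist_add hp1 hp4 hB x c
  have := hM x hx
  rw [hp3] at this
  dsimp only
  linarith

theorem le_geometric_of_succ_le (hp1 : ∀ x y : X, 0 ≤ p x x ∧ p x x ≤ p x y)
    (hp4 : ∀ x y z : X, p x y ≤ p x z + p z y - p z z) {x : ℕ → X} {C q : ℝ}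
    (hC : 0 ≤ C) (hq0 : 0 ≤ q) (hq1 : q < 1)
    (hx : ∀ n, p (x n) (x (n + 1)) ≤ C * q ^ n) (j n : ℕ) :
    p (x n) (x (n + j)) ≤ C / (1 - q) * q ^ n := by
  have hq : 0 < 1 - q := by linarith
  have key : C / (1 - q) * q ^ n = C * q ^ n + C / (1 - q) * q ^ (n + 1) := by
    field_simp
    ring
  have hpos (m : ℕ) : 0 ≤ C / (1 - q) * q ^ m := by positivity
  induction j generalizing n with
  | zero =>
    have := (hp1 (x n) (x (n + 1))).2
    rw [add_zero]
    linarith [hx n, hpos (n + 1)]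
  | succ j ih =>
    have h := ih (n + 1) (by field_simp; ring)
    rw [show n + 1 + j = n + (j + 1) by ring] at h
    linarith [hp4 (x n) (x (n + (j + 1))) (x (n + 1)), hx n, (hp1 (x (n + 1)) (x n)).1]

theorem tendsto_zero_of_succ_le_geometric (hp1 : ∀ x y : X, 0 ≤ p x x ∧ p x x ≤ p x y)
    (hp3 : ∀ x y : X, p x y = p y x)
    (hp4 : ∀ x y z : X, p x y ≤ p x z + p z y - p z z) {x : ℕ → X} {C q : ℝ}
    (hC : 0 ≤ C) (hq0 : 0 ≤ q) (hq1 : q < 1)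
    (hx : ∀ n, p (x n) (x (n + 1)) ≤ C * q ^ n) :
    Tendsto (fun i : ℕ × ℕ => p (x i.1) (x i.2)) (atTop ×ˢ atTop) (𝓝 0) := by
  have hK : 0 ≤ C / (1 - q) := div_nonneg hC (by linarith)
  have hpow := (tendsto_pow_atTop_nhds_zero_of_lt_one hq0 hq1).const_mul (C / (1 - q))
  have hsum : Tendsto (fun i : ℕ × ℕ => C / (1 - q) * q ^ i.1 + C / (1 - q) * q ^ i.2)
      (atTop ×ˢ atTop) (𝓝 0) := by
    simpa using (hpow.comp tendsto_fst).add (hpow.comp tendsto_snd)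
  refine squeeze_zero (fun i => (hp1 _ (x i.2)).1.trans (hp1 _ _).2) (fun ⟨m, n⟩ => ?_) hsum
  have hpos (m : ℕ) : 0 ≤ C / (1 - q) * q ^ m := by positivity
  rcases le_total m n with h | h
  · obtain ⟨j, rfl⟩ := Nat.exists_eq_add_of_le h
    linarith [le_geometric_of_succ_le hp1 hp4 hC hq0 hq1 hx j m, hpos (m + j)]
  · obtain ⟨j, rfl⟩ := Nat.exists_eq_add_of_le h
    dsimp only
    rw [hp3]
    linarith [le_geometric_of_succ_le hp1 hp4 hC hq0 hq1 hx j n, hpos (n + j)]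

theorem exists_orbit_le_geometric [Nonempty X] {T : X → Set X} (hT : ∀ x, (T x).Nonempty)
    {q : ℝ} (hq : 0 ≤ q) (hstep : ∀ x, ∀ y ∈ T x, ∃ z ∈ T y, p y z ≤ q * p x y) :
    ∃ x : ℕ → X, (∀ n, x (n + 1) ∈ T (x n)) ∧
      ∀ n, p (x n) (x (n + 1)) ≤ p (x 0) (x 1) * q ^ n := by
  choose g hg hgle using hstep
  obtain ⟨a⟩ := ‹Nonempty X›
  obtain ⟨b, hb⟩ := hT a
  let s : ℕ → {c : X × X // c.2 ∈ T c.1} := fun n =>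
    Nat.rec ⟨(a, b), hb⟩ (fun _ c => ⟨(c.1.2, g c.1.1 c.1.2 c.2), hg _ _ _⟩) n
  refine ⟨fun n => (s n).1.1, fun n => (s n).2, fun n => ?_⟩
  induction n with
  | zero => simp
  | succ n ih =>
    calc p (s (n + 1)).1.1 (s (n + 2)).1.1
        ≤ q * p (s n).1.1 (s (n + 1)).1.1 := hgle (s n).1.1 (s n).1.2 (s n).2
      _ ≤ q * (p (s 0).1.1 (s 1).1.1 * q ^ n) := mul_le_mul_of_nonneg_left ih hq
      _ = p (s 0).1.1 (s 1).1.1 * q ^ (n + 1) := by ring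

end PartialMetric

/-- Reich-type fixed point theorem for multi-valued maps. -/
theorem reich_multivalued_fixed_point
    {X : Type*} [Nonempty X] (p : X → X → ℝ)
    (hp1 : ∀ x y : X, 0 ≤ p x x ∧ p x x ≤ p x y)
    (hp2 : ∀ x y : X, x = y ↔ (p x x = p x y ∧ p x y = p y y))
    (hp3 : ∀ x y : X, p x y = p y x)
    (hp4 : ∀ x y z : X, p x y ≤ p x z + p z y - p z z)
    (hcomplete : pmComplete p)
    (T : X → Set X)
    (hT : ∀ x : X, (T x).Nonempty ∧ @IsClosed X (pmTop p) (T x) ∧ pmBounded p (T x))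
    (α β γ : ℝ) (hα : 0 ≤ α) (hβ : 0 ≤ β) (hγ : 0 ≤ γ) (hsum : α + β + γ < 1)
    (hcontr : ∀ x y : X,
      pmH p (T x) (T y) ≤ α * pmDistL p (T x) x + β * pmDistL p (T y) y + γ * p x y) :
    ∃ x : X, x ∈ T x := by
  have h0 (x y : X) : 0 ≤ p x y := (hp1 x y).1.trans (hp1 x y).2
  have hbound (x y z : X) (hy : y ∈ T x) :
      pmDist p y (T z) ≤ α * p x y + β * pmDist p z (T z) + γ * p x z := by
    have h := hcontr x z
    rw [pmDistL_eq_pmDist hp3, pmDistL_eq_pmDist hp3] at h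
    have := mul_le_mul_of_nonneg_left (pmDist_le h0 hy (x := x)) hα
    linarith [pmDist_le_pmH hp1 hp3 hp4 (hT x).2.2 (hT z).1 hy]
  have hβ' : 0 < 1 - β := by linarith
  obtain ⟨q, hkq, hq1⟩ : ∃ q, (α + γ) / (1 - β) < q ∧ q < 1 :=
    exists_between ((div_lt_one hβ').2 (by linarith))
  have hq0 : 0 ≤ q := le_trans (by positivity) hkq.le
  have hstep (x y : X) (hy : y ∈ T x) : ∃ z ∈ T y, p y z ≤ q * p x y := by
    rcases (h0 x y).eq_or_lt with h | h
    · have hxx : p x x = 0 := le_antisymm ((hp1 x y).2.trans h.ge) (h0 x x)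
      have hyy : p y y = 0 :=
        le_antisymm ((hp1 y x).2.trans ((hp3 y x).le.trans h.ge)) (h0 y y)
      obtain rfl := (hp2 x y).2 ⟨hxx.trans h, h.symm.trans hyy.symm⟩
      exact ⟨x, hy, by simp [hxx]⟩
    · have hle : pmDist p y (T y) ≤ (α + γ) / (1 - β) * p x y := by
        rw [div_mul_eq_mul_div, le_div_iff₀ hβ']
        linarith [hbound x y y hy]
      obtain ⟨z, hz, hlt⟩ := exists_lt_of_pmDist_lt (hT y).1
        (hle.trans_lt (mul_lt_mul_of_pos_right hkq h))
      exact ⟨z, hz, hlt.le⟩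
  obtain ⟨x, hxT, hx⟩ := exists_orbit_le_geometric (fun x => (hT x).1) hq0 hstep
  have hlim := tendsto_zero_of_succ_le_geometric hp1 hp3 hp4 (h0 _ _) hq0 hq1 hx
  obtain ⟨l, hl, hl'⟩ := hcomplete x ⟨0, hlim⟩
  have hll : p l l = 0 :=
    tendsto_nhds_unique hl' (hlim.comp (tendsto_id.prodMk tendsto_id))
  rw [hll] at hl
  have hsucc : Tendsto (fun n => p (x n) (x (n + 1))) atTop (𝓝 0) :=
    hlim.comp (tendsto_id.prodMk (tendsto_add_atTop_nat 1))
  have hshift : Tendsto (fun n => p (x (n + 1)) l) atTop (𝓝 0) :=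
    hl.comp (tendsto_add_atTop_nat 1)
  have hd : (1 - β) * pmDist p l (T l) ≤ 0 := by
    have hrhs : Tendsto
        (fun n => p (x (n + 1)) l + α * p (x n) (x (n + 1)) + γ * p (x n) l) atTop (𝓝 0) := by
      simpa using (hshift.add (hsucc.const_mul α)).add (hl.const_mul γ)
    refine ge_of_tendsto' hrhs fun n => ?_
    linarith [pmDist_le_pmDist_add hp1 hp4 (hT l).1 l (x (n + 1)), hp3 l (x (n + 1)),
      hbound (x n) (x (n + 1)) l (hxT n)]
  refine ⟨l, mem_of_isClosed_of_pmDist_le hp4 (hT l).1 (hT l).2.1 ?_⟩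
  rw [hll]
  exact nonpos_of_mul_nonpos_right hd hβ'
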